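/- arXiv:2410.13614 — 6 statements merged into one kernel-verified Lean document; each statement's English description precedes it below -/
import Mathlib

section
/- Let (X, f_{1,∞}) be a non-autonomous discrete system on a compact metric space X without isolated points, with f_{1,∞} commutative. If (X, f_{1,∞}) is topologically transitive and has a fixed point, then (X, f_{1,∞}) is Li-Yorke chaotic. -/
/-- `compSeq f i n = f (i+n-1) ∘ ⋯ ∘ f (i+1) ∘ f i` (with 0-based indexing,
`f i` here plays the role of `f_{i+1}` in the paper, so `compSeq f 0 n = f_1^n`). -/
def compSeq {X : Type*} (f : ℕ → X → X) (i : ℕ) : ℕ → X → X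
  | 0 => id
  | n + 1 => f (i + n) ∘ compSeq f i n

/-- Topological transitivity of the non-autonomous system `(X, f_{1,∞})`. -/
def NDSTransitive {X : Type*} [MetricSpace X] (f : ℕ → X → X) : Prop :=
  ∀ U V : Set X, IsOpen U → IsOpen V → U.Nonempty → V.Nonempty →
    ∃ n : ℕ, 0 < n ∧ ((compSeq f 0 n) '' U ∩ V).Nonempty

/-- Li-Yorke chaos of the non-autonomous system `(X, f_{1,∞})`. -/
def NDSLiYorkeChaotic {X : Type*} [MetricSpace X] (f : ℕ → X → X) : Prop :=
  ∃ S : Set X, ¬S.Countable ∧ ∀ x ∈ S, ∀ y ∈ S, x ≠ y →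
    Filter.liminf (fun n => dist (compSeq f 0 n x) (compSeq f 0 n y)) Filter.atTop = 0 ∧
    0 < Filter.limsup (fun n => dist (compSeq f 0 n x) (compSeq f 0 n y)) Filter.atTop

open Filter Topology

/-- A symmetric relation that is generic on generic fibres of a perfect Baire space has an
uncountable clique. -/
theorem exists_uncountable_pairwise_of_residual {X : Type*} [TopologicalSpace X] [T1Space X]
    [BaireSpace X] [Nonempty X] [∀ x : X, NeBot (𝓝[≠] x)] {r : X → X → Prop}
    (hsymm : ∀ x y, r x y → r y x) {A : Set X} (hA : A ∈ residual X)
    (hr : ∀ x ∈ A, {y | r x y} ∈ residual X) :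
    ∃ S : Set X, ¬S.Countable ∧ S.Pairwise r := by
  let rA : A → A → Prop := fun x y => r x y
  have hmax : IsMaxChain rA (maxChain rA) := maxChain_spec
  refine ⟨Subtype.val '' maxChain rA, fun hcount => ?_, ?_⟩
  · have hres : (⋂ x ∈ Subtype.val '' maxChain rA, {y | r x y} ∩ {x}ᶜ) ∩ A ∈ residual X := by
      refine inter_mem ((countable_bInter_mem hcount).2 ?_) hA
      rintro _ ⟨x, -, rfl⟩
      exact inter_mem (hr x x.2)
        (residual_of_dense_open isOpen_compl_singleton (dense_compl_singleton _))
    obtain ⟨y, hy, hyA⟩ := (dense_of_mem_residual hres).nonempty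
    simp only [Set.mem_iInter] at hy
    have hins : IsChain rA (insert ⟨y, hyA⟩ (maxChain rA)) :=
      hmax.1.insert fun x hx _ => Or.inr (hy x ⟨x, hx, rfl⟩).1
    have hmem : (⟨y, hyA⟩ : A) ∈ maxChain rA := by
      rw [hmax.2 hins (Set.subset_insert _ _)]
      exact Set.mem_insert _ _
    exact (hy y ⟨_, hmem, rfl⟩).2 rfl
  · rintro _ ⟨x, hx, rfl⟩ _ ⟨y, hy, rfl⟩ hxy
    rcases hmax.1 hx hy (fun h => hxy (congrArg _ h)) with h | h
    · exact h
    · exact hsymm _ _ h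

theorem setOf_frequently_mem_residual {X : Type*} [TopologicalSpace X] {O : ℕ → Set X}
    (hO : ∀ n, IsOpen (O n)) {D : Set X} (hD : Dense D)
    (h : ∀ y ∈ D, ∃ᶠ n in atTop, y ∈ O n) : {y | ∃ᶠ n in atTop, y ∈ O n} ∈ residual X := by
  have heq : {y | ∃ᶠ n in atTop, y ∈ O n} = ⋂ N, ⋃ n ≥ N, O n := by
    ext y
    simp [frequently_atTop]
  refine residual_of_dense_Gδ ?_ (hD.mono h)
  rw [heq]
  exact IsGδ.iInter fun N => (isOpen_biUnion fun n _ => hO n).isGδ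

theorem continuous_compSeq {X : Type*} [TopologicalSpace X] {f : ℕ → X → X}
    (hf : ∀ n, Continuous (f n)) (i n : ℕ) : Continuous (compSeq f i n) := by
  induction n with
  | zero => exact continuous_id
  | succ n ih => exact (hf _).comp ih

theorem commute_compSeq {X : Type*} {f : ℕ → X → X} {g : X → X}
    (hg : ∀ n, Function.Commute g (f n)) (i n : ℕ) : Function.Commute g (compSeq f i n) := by
  induction n with
  | zero => exact Function.Semiconj.id_right
  | succ n ih => exact (hg _).comp_right ih

theorem compSeq_eq_of_fixed {X : Type*} {f : ℕ → X → X} {v : X} (hv : ∀ n, f n v = v)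
    (i n : ℕ) : compSeq f i n v = v := by
  induction n with
  | zero => rfl
  | succ n ih => simp [compSeq, ih, hv]

theorem NDSTransitive.dense_orbit_mem_residual {X : Type*} [MetricSpace X] [CompactSpace X]
    {f : ℕ → X → X} (hf : ∀ n, Continuous (f n)) (h : NDSTransitive f) :
    {x | Dense (Set.range fun n => compSeq f 0 n x)} ∈ residual X := by
  let B := TopologicalSpace.countableBasis X
  have hB : TopologicalSpace.IsTopologicalBasis B := TopologicalSpace.isBasis_countableBasis X
  have hres : (⋂ V ∈ B, ⋃ n, compSeq f 0 n ⁻¹' V) ∈ residual X := by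
    refine (countable_bInter_mem (TopologicalSpace.countable_countableBasis X)).2 fun V hV => ?_
    refine residual_of_dense_open
      (isOpen_iUnion fun n => (hB.isOpen hV).preimage (continuous_compSeq hf 0 n)) ?_
    refine dense_iff_inter_open.2 fun U hU hUne => ?_
    obtain ⟨n, -, _, ⟨x, hxU, rfl⟩, hxV⟩ := h U V hU (hB.isOpen hV) hUne
      (TopologicalSpace.nonempty_of_mem_countableBasis hV)
    exact ⟨x, hxU, Set.mem_iUnion.2 ⟨n, hxV⟩⟩
  refine mem_of_superset hres fun x hx => hB.dense_iff.2 fun V hV _ => ?_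
  obtain ⟨n, hn⟩ := Set.mem_iUnion.1 (Set.mem_iInter₂.1 hx V hV)
  exact ⟨_, hn, n, rfl⟩

theorem mapClusterPt_of_dense_range {X : Type*} [TopologicalSpace X] [T1Space X]
    [∀ x : X, NeBot (𝓝[≠] x)] {u : ℕ → X} (hu : Dense (Set.range u)) (z : X) :
    MapClusterPt z atTop u := by
  refine mapClusterPt_iff_frequently.2 fun U hU => frequently_atTop.2 fun N => ?_
  have hd := hu.sdiff_finite ((Set.finite_Iio N).image u)
  obtain ⟨_, ⟨⟨n, rfl⟩, hn⟩, hyU⟩ := hd.inter_nhds_nonempty hU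
  exact ⟨n, not_lt.1 fun h => hn ⟨n, h, rfl⟩, hyU⟩

/-- If the orbit of `x` clusters at `z`, then the distance between the orbits of `x` and of
`g x`, for `g` commuting with the system, clusters at `dist z (g z)`. -/
theorem mapClusterPt_dist_compSeq {X : Type*} [MetricSpace X] {f : ℕ → X → X} {g : X → X}
    (hg : Continuous g) (hcomm : ∀ n, Function.Commute g (f n)) {x z : X}
    (h : MapClusterPt z atTop fun n => compSeq f 0 n x) :
    MapClusterPt (dist z (g z)) atTop
      fun n => dist (compSeq f 0 n x) (compSeq f 0 n (g x)) := by
  have hc := h.continuousAt_comp (f := fun y => dist y (g y)) (by fun_prop)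
  refine hc.congrFun (Eventually.of_forall fun n => ?_)
  simp only [Function.comp, (commute_compSeq hcomm 0 n).eq x]

theorem liminf_eq_zero_of_frequently_lt {u : ℕ → ℝ} (h0 : ∀ n, 0 ≤ u n)
    (hu : ∀ m : ℕ, ∃ᶠ n in atTop, u n < 1 / (m + 1 : ℝ)) : liminf u atTop = 0 := by
  have hbdd : IsBoundedUnder (· ≥ ·) atTop u := isBoundedUnder_of ⟨0, h0⟩
  refine le_antisymm (le_of_forall_pos_le_add fun ε hε => ?_) ?_
  · obtain ⟨m, hm⟩ := exists_nat_one_div_lt hε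
    rw [zero_add]
    exact liminf_le_of_frequently_le ((hu m).mono fun n hn => (hn.trans hm).le) hbdd
  · refine le_liminf_of_le ?_ (Eventually.of_forall h0)
    exact IsCobounded.of_frequently_le ((hu 0).mono fun n hn => hn.le)

/-- a compact, commutative NDS without isolated points which is
topologically transitive and has a fixed point is Li-Yorke chaotic. -/
theorem stmt0 {X : Type*} [MetricSpace X] [CompactSpace X]
    (hiso : ∀ x : X, Filter.NeBot (nhdsWithin x {x}ᶜ))
    (f : ℕ → X → X) (hcont : ∀ n, Continuous (f n))
    (hcomm : ∀ i j, f i ∘ f j = f j ∘ f i)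
    (htrans : NDSTransitive f)
    (hfix : ∃ v : X, ∀ n, f n v = v) :
    NDSLiYorkeChaotic f := by
  obtain ⟨v, hv⟩ := hfix
  have : Nonempty X := ⟨v⟩
  let d : X → X → ℕ → ℝ := fun x y n => dist (compSeq f 0 n x) (compSeq f 0 n y)
  let r : X → X → Prop := fun x y => ∀ m : ℕ,
    (∃ᶠ n in atTop, d x y n < 1 / (m + 1 : ℝ)) ∧
      ∃ᶠ n in atTop, dist x y - 1 / (m + 1 : ℝ) < d x y n
  have hsymm : ∀ x y, r x y → r y x := fun x y h => by
    simpa only [r, d, dist_comm y x, dist_comm (compSeq f 0 _ y)] using h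
  have hF := continuous_compSeq hcont 0
  have hr : ∀ x ∈ {x | Dense (Set.range fun n => compSeq f 0 n x)},
      {y | r x y} ∈ residual X := by
    intro x hx
    have hclus : ∀ z, ∀ y ∈ Set.range (fun n => compSeq f 0 n x),
        ∃ j, y = compSeq f 0 j x ∧ MapClusterPt (dist z (compSeq f 0 j z)) atTop (d x y) := by
      rintro z _ ⟨j, rfl⟩
      refine ⟨j, rfl, mapClusterPt_dist_compSeq (hF j) (fun n => ?_)
        (mapClusterPt_of_dense_range hx z)⟩
      exact (commute_compSeq (fun i y => congrFun (hcomm n i) y) 0 j).symm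
    simp only [r, Set.ofPred_forall, Set.ofPred_and]
    refine countable_iInter_mem.2 fun m => ?_
    have hm : (0 : ℝ) < 1 / (m + 1 : ℝ) := Nat.one_div_pos_of_nat
    refine inter_mem (setOf_frequently_mem_residual
      (O := fun n => {y | d x y n < 1 / (m + 1 : ℝ)}) (fun n => ?_) hx fun y hy => ?_)
      (setOf_frequently_mem_residual
      (O := fun n => {y | dist x y - 1 / (m + 1 : ℝ) < d x y n}) (fun n => ?_) hx fun y hy => ?_)
    · exact isOpen_lt (continuous_const.dist (hF n)) continuous_const
    · obtain ⟨j, -, hj⟩ := hclus v y hy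
      rw [compSeq_eq_of_fixed hv, dist_self] at hj
      exact hj.frequently (Iio_mem_nhds hm)
    · exact isOpen_lt ((continuous_const.dist continuous_id).sub continuous_const)
        (continuous_const.dist (hF n))
    · obtain ⟨j, rfl, hj⟩ := hclus x y hy
      exact hj.frequently (Ioi_mem_nhds (sub_lt_self _ hm))
  obtain ⟨S, hS, hpair⟩ := exists_uncountable_pairwise_of_residual hsymm
    (htrans.dense_orbit_mem_residual hcont) hr
  refine ⟨S, hS, fun x hx y hy hxy => ⟨?_, ?_⟩⟩
  · exact liminf_eq_zero_of_frequently_lt (fun _ => dist_nonneg) fun m => (hpair hx hy hxy m).1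
  · obtain ⟨m, hm⟩ := exists_nat_one_div_lt (dist_pos.2 hxy)
    refine (sub_pos.2 hm).trans_le (le_limsup_of_frequently_le
      ((hpair hx hy hxy m).2.mono fun n hn => hn.le) ?_)
    exact isBoundedUnder_of ⟨Metric.diam (Set.univ : Set X), fun n =>
      Metric.dist_le_diam_of_mem isCompact_univ.isBounded trivial trivial⟩
end

section
/- Let (X, f_{1,∞}) be a non-autonomous discrete system on a metric space X containing at least two points. If f_{1,∞} is weakly mixing, then f_{1,∞} is Kato's chaotic, i.e., it is both sensitive and accessible. -/
/-- Weak mixing of an NDS. -/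
def NDSWeaklyMixing {X : Type*} [MetricSpace X] (f : ℕ → X → X) : Prop :=
  ∀ U₁ U₂ V₁ V₂ : Set X, IsOpen U₁ → IsOpen U₂ → IsOpen V₁ → IsOpen V₂ →
    U₁.Nonempty → U₂.Nonempty → V₁.Nonempty → V₂.Nonempty →
    ∃ n : ℕ, 0 < n ∧ ((compSeq f 0 n) '' U₁ ∩ V₁).Nonempty ∧
      ((compSeq f 0 n) '' U₂ ∩ V₂).Nonempty

/-- Sensitivity of an NDS. -/
def NDSSensitive {X : Type*} [MetricSpace X] (f : ℕ → X → X) : Prop :=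
  ∃ δ > (0 : ℝ), ∀ U : Set X, IsOpen U → U.Nonempty →
    ∃ x ∈ U, ∃ y ∈ U, ∃ n : ℕ, 0 < n ∧ δ < dist (compSeq f 0 n x) (compSeq f 0 n y)

/-- Accessibility of an NDS. -/
def NDSAccessible {X : Type*} [MetricSpace X] (f : ℕ → X → X) : Prop :=
  ∀ ε > (0 : ℝ), ∀ U V : Set X, IsOpen U → IsOpen V → U.Nonempty → V.Nonempty →
    ∃ x ∈ U, ∃ y ∈ V, ∃ n : ℕ, 0 < n ∧ dist (compSeq f 0 n x) (compSeq f 0 n y) < ε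

/-- weak mixing implies Kato's chaos (sensitivity plus accessibility). -/
theorem stmt4 {X : Type*} [MetricSpace X] [Nontrivial X]
    (f : ℕ → X → X) (hcont : ∀ n, Continuous (f n))
    (hwm : NDSWeaklyMixing f) :
    NDSSensitive f ∧ NDSAccessible f := by
  constructor
  · obtain ⟨a, b, hab⟩ := exists_pair_ne X
    have hd : 0 < dist a b := dist_pos.mpr hab
    refine ⟨dist a b / 4, by positivity, fun U hU hUne => ?_⟩
    have hr : 0 < dist a b / 4 := by positivity
    obtain ⟨n, hn, ⟨_, ⟨x, hx, rfl⟩, hxa⟩, ⟨_, ⟨y, hy, rfl⟩, hyb⟩⟩ :=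
      hwm U U (Metric.ball a (dist a b / 4)) (Metric.ball b (dist a b / 4)) hU hU
        Metric.isOpen_ball Metric.isOpen_ball hUne hUne
        (Metric.nonempty_ball.mpr hr) (Metric.nonempty_ball.mpr hr)
    refine ⟨x, hx, y, hy, n, hn, ?_⟩
    rw [Metric.mem_ball'] at hxa
    rw [Metric.mem_ball] at hyb
    linarith [dist_triangle4 a (compSeq f 0 n x) (compSeq f 0 n y) b]
  · intro ε hε U V hU hV hUne hVne
    obtain ⟨a⟩ : Nonempty X := inferInstance
    have hball : (Metric.ball a (ε / 2)).Nonempty := Metric.nonempty_ball.mpr (half_pos hε)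
    obtain ⟨n, hn, ⟨_, ⟨x, hx, rfl⟩, hxa⟩, ⟨_, ⟨y, hy, rfl⟩, hya⟩⟩ :=
      hwm U V _ _ hU hV Metric.isOpen_ball Metric.isOpen_ball hUne hVne hball hball
    refine ⟨x, hx, y, hy, n, hn, ?_⟩
    rw [Metric.mem_ball] at hxa
    rw [Metric.mem_ball'] at hya
    linarith [dist_triangle (compSeq f 0 n x) a (compSeq f 0 n y)]
end

section
/- Let (X, f_{1,∞}) be a finitely generated non-autonomous discrete system on a metric space X. Assume that (1) (X, f_{1,∞}) is topologically transitive, (2) the periodic points of f_{1,∞} are dense in X, and (3) there exist two invariant periodic points p₁, p₂ ∈ X whose orbit closures are disjoint: cl(orb(p₁, f_{1,∞})) ∩ cl(orb(p₂, f_{1,∞})) = ∅. Then (X, f_{1,∞}) is sensitive. -/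
/-- Orbit of `x` under the non-autonomous system: `{f_1^n(x) : n ≥ 0}`. -/
def NDSOrbit {X : Type*} (f : ℕ → X → X) (x : X) : Set X :=
  Set.range fun n => compSeq f 0 n x

/-- `x` is a periodic point of the NDS: for some period `N ≥ 1`, `f_1^{jN}(x) = x`
for all `j ≥ 1`. -/
def NDSPeriodicPt {X : Type*} (f : ℕ → X → X) (x : X) : Prop :=
  ∃ N : ℕ, 0 < N ∧ ∀ j : ℕ, 0 < j → compSeq f 0 (j * N) x = x

/-- In a finitely generated system, the orbit of a periodic point is finite. -/
theorem NDSPeriodicPt.finite_orbit {X : Type*} {f : ℕ → X → X}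
    (hfin : (Set.range f).Finite) {p : X} (hp : NDSPeriodicPt f p) :
    (NDSOrbit f p).Finite := by
  obtain ⟨N, hN, hper⟩ := hp
  have hrow : ∀ i, (Set.range fun j => compSeq f 0 (j * N + i) p).Finite := by
    intro i
    induction i with
    | zero =>
      refine (Set.finite_singleton p).subset ?_
      rintro _ ⟨j, rfl⟩
      rcases Nat.eq_zero_or_pos j with rfl | hj
      · simp [compSeq]
      · exact hper j hj
    | succ i ih =>
      refine (hfin.image2 (fun g x => g x) ih).subset ?_
      rintro _ ⟨j, rfl⟩
      exact ⟨f (0 + (j * N + i)), ⟨_, rfl⟩, _, ⟨j, rfl⟩, rfl⟩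
  refine ((Set.finite_Iio N).biUnion fun i _ => hrow i).subset ?_
  rintro _ ⟨n, rfl⟩
  refine Set.mem_biUnion (Nat.mod_lt n hN) ⟨n / N, ?_⟩
  simp only [Nat.div_add_mod']

/-- Near a set invariant under a finitely generated system, trajectories remain in a given
neighbourhood for any prescribed number of steps, uniformly in the starting time. -/
theorem exists_isOpen_forall_compSeq_mem {X : Type*} [TopologicalSpace X]
    {f : ℕ → X → X} (hcont : ∀ n, Continuous (f n)) (hfin : (Set.range f).Finite)
    {A T : Set X} (hA : ∀ i, f i '' A ⊆ A) (hT : IsOpen T) (hAT : A ⊆ T) (n : ℕ) :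
    ∃ W, IsOpen W ∧ A ⊆ W ∧ ∀ k y, compSeq f 0 k y ∈ W →
      ∀ i ≤ n, compSeq f 0 (k + i) y ∈ T := by
  induction n with
  | zero =>
    refine ⟨T, hT, hAT, fun k y hy i hi => ?_⟩
    obtain rfl : i = 0 := by omega
    exact hy
  | succ n ih =>
    obtain ⟨W, hW, hAW, hstay⟩ := ih
    refine ⟨T ∩ ⋂ g ∈ Set.range f, g ⁻¹' W, hT.inter (hfin.isOpen_biInter ?_), ?_, ?_⟩
    · rintro _ ⟨i, rfl⟩
      exact hW.preimage (hcont i)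
    · refine Set.subset_inter hAT (Set.subset_iInter₂ ?_)
      rintro _ ⟨i, rfl⟩
      exact Set.image_subset_iff.1 ((hA i).trans hAW)
    · rintro k y ⟨hyT, hyW⟩ (_ | i) hi
      · exact hyT
      · have hnext : compSeq f 0 (k + 1) y ∈ W := Set.mem_iInter₂.1 hyW _ ⟨0 + k, rfl⟩
        have := hstay (k + 1) y hnext i (by omega)
        rwa [show k + (i + 1) = k + 1 + i by omega]

/-- An open set containing a point far from a nonempty invariant set contains two points
whose trajectories separate. -/
theorem NDSTransitive.exists_lt_dist {X : Type*} [MetricSpace X]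
    {f : ℕ → X → X} (hcont : ∀ n, Continuous (f n)) (hfin : (Set.range f).Finite)
    (htrans : NDSTransitive f) (hdense : Dense {x : X | NDSPeriodicPt f x})
    {A : Set X} (hA : ∀ i, f i '' A ⊆ A) (hne : A.Nonempty) {ε : ℝ} (hε : 0 < ε)
    {U : Set X} (hU : IsOpen U) {x : X} (hx : x ∈ U)
    (hfar : x ∉ Metric.thickening (3 * ε) A) :
    ∃ y ∈ U, ∃ z ∈ U, ∃ n : ℕ, 0 < n ∧ ε < dist (compSeq f 0 n y) (compSeq f 0 n z) := by
  obtain ⟨q, ⟨hqU, hqx⟩, N, hN, hper⟩ := hdense.inter_open_nonempty _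
    (hU.inter Metric.isOpen_ball) ⟨x, hx, Metric.mem_ball_self hε⟩
  obtain ⟨W, hW, hAW, hstay⟩ := exists_isOpen_forall_compSeq_mem hcont hfin hA
    Metric.isOpen_thickening (Metric.self_subset_thickening hε A) N
  obtain ⟨k, hk, _, ⟨y, hyU, rfl⟩, hyW⟩ := htrans U W hU hW ⟨x, hx⟩ (hne.mono hAW)
  have hle : k ≤ (k / N + 1) * N := by
    have := Nat.div_add_mod' k N
    have := Nat.mod_lt k hN
    rw [add_mul]
    omega
  have hsub : (k / N + 1) * N - k ≤ N := by
    have := Nat.div_mul_le_self k N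
    rw [add_mul]
    omega
  have hnear := hstay k y hyW _ hsub
  rw [Nat.add_sub_cancel' hle] at hnear
  obtain ⟨a, haA, ha⟩ := Metric.mem_thickening_iff.1 hnear
  refine ⟨y, hyU, q, hqU, _, hk.trans_le hle, ?_⟩
  rw [hper _ (Nat.succ_pos _)]
  have hxa : 3 * ε ≤ dist x a := by
    by_contra! h
    exact hfar (Metric.mem_thickening_iff.2 ⟨a, haA, h⟩)
  rw [Metric.mem_ball, dist_comm] at hqx
  have := dist_triangle4 x q (compSeq f 0 ((k / N + 1) * N) y) a
  rw [dist_comm q] at this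
  linarith

/-- a finitely generated, topologically transitive NDS with dense
periodic points having two invariant periodic points with disjoint orbit closures
is sensitive. -/
theorem stmt5 {X : Type*} [MetricSpace X]
    (f : ℕ → X → X) (hcont : ∀ n, Continuous (f n))
    (hfin : (Set.range f).Finite)
    (htrans : NDSTransitive f)
    (hdense : Dense {x : X | NDSPeriodicPt f x})
    (p₁ p₂ : X) (hp₁ : NDSPeriodicPt f p₁) (hp₂ : NDSPeriodicPt f p₂)
    (hinv₁ : ∀ i, f i '' NDSOrbit f p₁ ⊆ NDSOrbit f p₁)
    (hinv₂ : ∀ i, f i '' NDSOrbit f p₂ ⊆ NDSOrbit f p₂)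
    (hdisj : closure (NDSOrbit f p₁) ∩ closure (NDSOrbit f p₂) = ∅) :
    NDSSensitive f := by
  have hcpt := (hp₁.finite_orbit hfin).isCompact
  have hdisj' : Disjoint (NDSOrbit f p₁) (closure (NDSOrbit f p₂)) :=
    (Set.disjoint_iff_inter_eq_empty.2 hdisj).mono_left subset_closure
  obtain ⟨δ, hδ, hthick⟩ := hdisj'.exists_thickenings hcpt isClosed_closure
  rw [Metric.thickening_closure] at hthick
  refine ⟨δ / 3, by positivity, ?_⟩
  rintro U hU ⟨x, hx⟩
  have hδ' : 3 * (δ / 3) = δ := by ring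
  by_cases hx₁ : x ∈ Metric.thickening δ (NDSOrbit f p₁)
  · exact htrans.exists_lt_dist hcont hfin hdense hinv₂ (Set.range_nonempty _) (by positivity)
      hU hx (by rw [hδ']; exact Set.disjoint_left.1 hthick hx₁)
  · exact htrans.exists_lt_dist hcont hfin hdense hinv₁ (Set.range_nonempty _) (by positivity)
      hU hx (by rwa [hδ'])
end

section
/- Let (X, f_{1,∞}) be a non-autonomous discrete system on a metric space X containing at least two points. If f_{1,∞} is mixing, then f_{1,∞} is cofinitely sensitive. -/
/-- Mixing of an NDS. -/
def NDSMixing {X : Type*} [MetricSpace X] (f : ℕ → X → X) : Prop :=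
  ∀ U V : Set X, IsOpen U → IsOpen V → U.Nonempty → V.Nonempty →
    ∃ N : ℕ, ∀ n : ℕ, N ≤ n → ((compSeq f 0 n) '' U ∩ V).Nonempty

/-- Cofinite sensitivity of an NDS: some `δ > 0` such that for every nonempty open
set `U` the set `N_{f_{1,∞}}(U, δ)` is cofinite in `ℕ`. -/
def NDSCofinitelySensitive {X : Type*} [MetricSpace X] (f : ℕ → X → X) : Prop :=
  ∃ δ > (0 : ℝ), ∀ U : Set X, IsOpen U → U.Nonempty →
    ∃ N : ℕ, ∀ n : ℕ, N ≤ n →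
      ∃ x ∈ U, ∃ y ∈ U, δ < dist (compSeq f 0 n x) (compSeq f 0 n y)

/-- a mixing NDS on a metric space with at least two points is
cofinitely sensitive. -/
theorem stmt9 {X : Type*} [MetricSpace X] [Nontrivial X]
    (f : ℕ → X → X) (hcont : ∀ n, Continuous (f n))
    (hmix : NDSMixing f) :
    NDSCofinitelySensitive f := by
  obtain ⟨a, b, hab⟩ := exists_pair_ne X
  have hd : 0 < dist a b := dist_pos.mpr hab
  have hr : 0 < dist a b / 4 := by positivity
  refine ⟨dist a b / 4, hr, fun U hU hne => ?_⟩
  obtain ⟨M, hM⟩ := hmix U (Metric.ball a (dist a b / 4)) hU Metric.isOpen_ball hne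
    ⟨a, Metric.mem_ball_self hr⟩
  obtain ⟨N, hN⟩ := hmix U (Metric.ball b (dist a b / 4)) hU Metric.isOpen_ball hne
    ⟨b, Metric.mem_ball_self hr⟩
  refine ⟨max M N, fun n hn => ?_⟩
  obtain ⟨_, ⟨x, hx, rfl⟩, hxa⟩ := hM n (le_of_max_le_left hn)
  obtain ⟨_, ⟨y, hy, rfl⟩, hyb⟩ := hN n (le_of_max_le_right hn)
  refine ⟨x, hx, y, hy, ?_⟩
  rw [Metric.mem_ball] at hxa hyb
  have := dist_triangle4 a (compSeq f 0 n x) (compSeq f 0 n y) b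
  rw [dist_comm a (compSeq f 0 n x)] at this
  linarith
end

section
/- Let (X, f_{1,∞}) be a k-periodic non-autonomous discrete system on a metric space X and let g = f_k ∘ f_{k-1} ∘ ⋯ ∘ f_1. (i) If (X, f_{1,∞}) is cofinitely sensitive, then the autonomous system (X, g) is cofinitely sensitive. (ii) Conversely, if each f_p (p = 1, …, k) is uniformly continuous and (X, g) is cofinitely sensitive, then (X, f_{1,∞}) is cofinitely sensitive. -/
/-- Cofinite sensitivity of an autonomous system `(X, g)`. -/
def AutCofinitelySensitive {X : Type*} [MetricSpace X] (g : X → X) : Prop :=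
  ∃ δ > (0 : ℝ), ∀ U : Set X, IsOpen U → U.Nonempty →
    ∃ N : ℕ, ∀ n : ℕ, N ≤ n →
      ∃ x ∈ U, ∃ y ∈ U, δ < dist (g^[n] x) (g^[n] y)

theorem compSeq_add {X : Type*} (f : ℕ → X → X) (i m n : ℕ) :
    compSeq f i (m + n) = compSeq f (i + m) n ∘ compSeq f i m := by
  induction n with
  | zero => rfl
  | succ n ih =>
    change f (i + (m + n)) ∘ compSeq f i (m + n) = _
    rw [ih, ← Nat.add_assoc]
    rfl

theorem compSeq_congr {X : Type*} {f : ℕ → X → X} {i j : ℕ}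
    (h : ∀ n, f (i + n) = f (j + n)) (n : ℕ) : compSeq f i n = compSeq f j n := by
  induction n with
  | zero => rfl
  | succ n ih =>
    change f (i + n) ∘ compSeq f i n = f (j + n) ∘ compSeq f j n
    rw [ih, h]

theorem compSeq_mod {X : Type*} {f : ℕ → X → X} {k : ℕ} (hper : Function.Periodic f k)
    (i n : ℕ) : compSeq f (i % k) n = compSeq f i n := by
  refine compSeq_congr (fun m => ?_) n
  rw [← hper.map_mod_nat (i % k + m), Nat.mod_add_mod, hper.map_mod_nat]

theorem compSeq_mul {X : Type*} {f : ℕ → X → X} {k : ℕ} (hper : Function.Periodic f k)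
    (m : ℕ) : compSeq f 0 (k * m) = (compSeq f 0 k)^[m] := by
  induction m with
  | zero => rfl
  | succ m ih =>
    rw [Nat.mul_succ, compSeq_add, ih, Function.iterate_succ', ← compSeq_mod hper (0 + k * m)]
    simp

theorem uniformContinuous_compSeq {X : Type*} [UniformSpace X] {f : ℕ → X → X}
    (hf : ∀ n, UniformContinuous (f n)) (i n : ℕ) : UniformContinuous (compSeq f i n) := by
  induction n with
  | zero => exact uniformContinuous_id
  | succ n ih => exact (hf (i + n)).comp ih

/-- Blocks of bounded length in a periodic uniformly continuous system are uniformly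
equicontinuous. -/
theorem uniformEquicontinuous_compSeq {X : Type*} [UniformSpace X] {f : ℕ → X → X} {k : ℕ}
    (hk : 0 < k) (hper : Function.Periodic f k) (hf : ∀ n, UniformContinuous (f n)) (R : ℕ) :
    UniformEquicontinuous (fun q : ℕ × Fin R => compSeq f q.1 q.2) := by
  have h : UniformEquicontinuous (fun q : Fin k × Fin R => compSeq f q.1 q.2) :=
    uniformEquicontinuous_finite.2 fun q => uniformContinuous_compSeq hf _ _
  convert h.comp (fun q : ℕ × Fin R => (⟨q.1 % k, Nat.mod_lt _ hk⟩, q.2)) using 1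
  funext q
  exact (compSeq_mod hper q.1 q.2).symm

/-- for a `k`-periodic NDS with `g = f_k ∘ ⋯ ∘ f_1`:
(i) cofinite sensitivity of `(X, f_{1,∞})` implies cofinite sensitivity of `(X, g)`;
(ii) conversely if each `f_p` is uniformly continuous. -/
theorem stmt14 {X : Type*} [MetricSpace X]
    (k : ℕ) (hk : 0 < k)
    (f : ℕ → X → X) (hcont : ∀ n, Continuous (f n))
    (hper : ∀ n, f (n + k) = f n) :
    (NDSCofinitelySensitive f → AutCofinitelySensitive (compSeq f 0 k)) ∧
    ((∀ p, p < k → UniformContinuous (f p)) →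
      AutCofinitelySensitive (compSeq f 0 k) → NDSCofinitelySensitive f) := by
  have hp : Function.Periodic f k := hper
  constructor
  · rintro ⟨δ, hδ, h⟩
    refine ⟨δ, hδ, fun U hU hne => ?_⟩
    obtain ⟨N, hN⟩ := h U hU hne
    refine ⟨N, fun n hn => ?_⟩
    rw [← compSeq_mul hp]
    exact hN _ (hn.trans (Nat.le_mul_of_pos_left n hk))
  · rintro huc ⟨δ, hδ, h⟩
    have huc' : ∀ n, UniformContinuous (f n) := fun n =>
      hp.map_mod_nat n ▸ huc _ (Nat.mod_lt n hk)
    obtain ⟨η, hη, hequi⟩ := Metric.uniformEquicontinuous_iff.1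
      (uniformEquicontinuous_compSeq hk hp huc' (k + 1)) δ hδ
    refine ⟨η / 2, half_pos hη, fun U hU hne => ?_⟩
    obtain ⟨N, hN⟩ := h U hU hne
    refine ⟨k * N, fun n hn => ?_⟩
    have hlt : n < k * (n / k + 1) := Nat.lt_mul_div_succ n hk
    have hle : k * (n / k + 1) ≤ n + k := by
      rw [Nat.mul_succ]
      exact Nat.add_le_add_right (Nat.mul_div_le n k) k
    obtain ⟨r, hr⟩ := Nat.exists_eq_add_of_lt hlt
    have hNn : N ≤ n / k + 1 :=
      ((Nat.le_div_iff_mul_le hk).2 (by rwa [Nat.mul_comm])).trans (Nat.le_succ _)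
    obtain ⟨x, hx, y, hy, hxy⟩ := hN _ hNn
    refine ⟨x, hx, y, hy, ?_⟩
    by_contra! hcon
    rw [← compSeq_mul hp, hr, Nat.add_assoc, compSeq_add, Nat.zero_add] at hxy
    exact hxy.not_gt
      (hequi _ _ (hcon.trans_lt (half_lt_self hη)) (n, ⟨r + 1, by omega⟩))
end

section
/- Let (X, f_{1,∞}) be a k-periodic non-autonomous discrete system on a compact metric space X without isolated points, with f_{1,∞} commutative and each f_i surjective. If f_{1,∞} is topologically transitive and there exists a nonrecurrent point x₁ ∈ X, then f_{1,∞} is sensitive. -/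
theorem compSeq_continuous {X : Type*} [TopologicalSpace X] {f : ℕ → X → X}
    (hcont : ∀ n, Continuous (f n)) (i n : ℕ) : Continuous (compSeq f i n) := by
  induction n with
  | zero => exact continuous_id
  | succ n ih => exact (hcont _).comp ih

theorem Function.Commute.compSeq_right {X : Type*} {f : ℕ → X → X} {g : X → X}
    (hg : ∀ j, Function.Commute g (f j)) (i n : ℕ) : Function.Commute g (compSeq f i n) := by
  induction n with
  | zero => exact Function.Commute.id_right
  | succ n ih => exact (hg _).comp_right ih

theorem compSeq_commute {X : Type*} {f : ℕ → X → X}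
    (hcomm : ∀ i j, f i ∘ f j = f j ∘ f i) (i m j n : ℕ) :
    Function.Commute (compSeq f i m) (compSeq f j n) := by
  have hf : ∀ a b, Function.Commute (f a) (f b) := fun a b => congrFun (hcomm a b)
  exact .compSeq_right (fun l => (Function.Commute.compSeq_right (hf l) i m).symm) j n

/-- If a transitive commutative system is not sensitive, some positive iterate is uniformly
`ε`-close to the identity. -/
theorem NDSTransitive.exists_dist_compSeq_le {X : Type*} [MetricSpace X] {f : ℕ → X → X}
    (hcont : ∀ n, Continuous (f n)) (hcomm : ∀ i j, f i ∘ f j = f j ∘ f i)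
    (htrans : NDSTransitive f) (hsens : ¬ NDSSensitive f) {ε : ℝ} (hε : 0 < ε) :
    ∃ m, 0 < m ∧ ∀ y, dist (compSeq f 0 m y) y ≤ ε := by
  obtain ⟨U, hU, hUne, hclose⟩ : ∃ U : Set X, IsOpen U ∧ U.Nonempty ∧ ∀ x ∈ U, ∀ y ∈ U,
      ∀ n, 0 < n → dist (compSeq f 0 n x) (compSeq f 0 n y) ≤ ε := by
    unfold NDSSensitive at hsens
    push Not at hsens
    exact hsens ε hε
  obtain ⟨m, hm, -, ⟨u, hu, rfl⟩, hmu⟩ := htrans U U hU hU hUne hUne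
  refine ⟨m, hm, fun y => ?_⟩
  by_contra! hy
  have hcm := compSeq_continuous hcont 0 m
  obtain ⟨n, hn, -, ⟨v, ⟨hvU, hvm⟩, rfl⟩, hv⟩ :=
    htrans (U ∩ compSeq f 0 m ⁻¹' U) {z | ε < dist (compSeq f 0 m z) z}
      (hU.inter (hU.preimage hcm)) (isOpen_lt continuous_const (hcm.dist continuous_id))
      ⟨u, hu, hmu⟩ ⟨y, hy⟩
  have hle := hclose _ hvm v hvU n hn
  rw [(compSeq_commute hcomm 0 n 0 m).eq v] at hle
  exact hle.not_gt hv

/-- a surjective, compact, commutative, `k`-periodic NDS without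
isolated points which is transitive and has a nonrecurrent point is sensitive. -/
theorem stmt18 {X : Type*} [MetricSpace X] [CompactSpace X]
    (hiso : ∀ x : X, Filter.NeBot (nhdsWithin x {x}ᶜ))
    (k : ℕ) (hk : 0 < k)
    (f : ℕ → X → X) (hcont : ∀ n, Continuous (f n))
    (hper : ∀ n, f (n + k) = f n)
    (hcomm : ∀ i j, f i ∘ f j = f j ∘ f i)
    (hsurj : ∀ n, Function.Surjective (f n))
    (htrans : NDSTransitive f)
    (x₁ : X)
    (hnonrec : x₁ ∉ closure (Set.range fun i : ℕ => compSeq f 0 (i + 1) x₁)) :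
    NDSSensitive f := by
  by_contra hsens
  obtain ⟨ε, hε, hfar⟩ : ∃ ε > (0 : ℝ), ∀ i, ε ≤ dist x₁ (compSeq f 0 (i + 1) x₁) := by
    simpa [Metric.mem_closure_iff] using hnonrec
  obtain ⟨m, hm, hclose⟩ := htrans.exists_dist_compSeq_le hcont hcomm hsens (half_pos hε)
  obtain ⟨i, rfl⟩ := Nat.exists_eq_add_of_lt hm
  have h₁ := hclose x₁
  have h₂ := hfar i
  rw [dist_comm, zero_add] at h₁
  linarith
end
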